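/- For all integers l ≥ 2 and 1 ≤ k ≤ l−1, one has the exact identity C(2l−2, 2k−1) · t_{2k−1} · t_{2(l−k)−1} = (4 · (2l−2)! / π^{2l}) · f_k, where f_k = (4^k − 1) ζ(2k) (4^{l−k} − 1) ζ(2(l−k)). In particular, the probability P(M = 2k−1) that the left subtree of a uniform strictly increasing binary tree of size n = 2l−1 has size 2k−1 is proportional to f_k. -/

import Mathlib

open Real

/-- The Riemann zeta function at positive integer arguments,
`ζ(s) = Σ_{i ≥ 1} 1/i^s`. -/
noncomputable def zeta (s : ℕ) : ℝ := ∑' i : ℕ+, (1 : ℝ) / (i : ℝ) ^ s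

/-- `t n = n! · [z^n] tan z`, i.e. the `n`-th derivative of `tan` at `0`;
it counts strictly increasing binary trees of size `n`. -/
noncomputable def t (n : ℕ) : ℝ := iteratedDeriv n Real.tan 0

/-- `f l k = (4^k − 1) ζ(2k) (4^{l−k} − 1) ζ(2(l−k))`. -/
noncomputable def f (l k : ℕ) : ℝ :=
  (4 ^ k - 1) * zeta (2 * k) * ((4 ^ (l - k) - 1) * zeta (2 * (l - k)))

/-- Real form of the Mittag-Leffler expansion of the cotangent. -/
lemma real_cot_series (x : ℝ) (hx0 : x ≠ 0) (hx1 : |x| < 1) :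
    1 / x - π * (Real.cos (π * x) / Real.sin (π * x)) =
      ∑' n : ℕ, 2 * x / (((n : ℝ) + 1) ^ 2 - x ^ 2) := by
  have hmem : (x : ℂ) ∈ Complex.integerComplement := by
    rintro ⟨m, hm⟩
    have hm' : (m : ℝ) = x := by exact_mod_cast hm
    rw [← hm'] at hx0 hx1
    have h1 : |m| < 1 := by exact_mod_cast hx1
    have h2 : m = 0 := Int.abs_lt_one_iff.mp h1
    simp [h2] at hx0
  have h := cot_series_rep' hmem
  have hterm : ∀ n : ℕ, (1 / ((x : ℂ) - (n + 1)) + 1 / ((x : ℂ) + (n + 1))) =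
      ((-(2 * x / (((n : ℝ) + 1) ^ 2 - x ^ 2)) : ℝ) : ℂ) := by
    intro n
    have hn : (0 : ℝ) ≤ n := n.cast_nonneg
    obtain ⟨ha, hb⟩ := abs_lt.mp hx1
    have e1 : x - (n + 1) ≠ 0 := by
      intro h0
      linarith
    have e2 : x + (n + 1) ≠ 0 := by
      intro h0
      linarith
    have e3 : ((n : ℝ) + 1) ^ 2 - x ^ 2 ≠ 0 := by
      have : ((n : ℝ) + 1) ^ 2 - x ^ 2 = -((x - (n + 1)) * (x + (n + 1))) := by ring
      rw [this]
      exact neg_ne_zero.mpr (mul_ne_zero e1 e2)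
    have : (1 / (x - (n + 1)) + 1 / (x + (n + 1))) =
        (-(2 * x / (((n : ℝ) + 1) ^ 2 - x ^ 2)) : ℝ) := by
      field_simp
      ring
    rw [← this]
    push_cast
    rfl
  simp_rw [hterm] at h
  rw [← Complex.ofReal_tsum, tsum_neg, Complex.cot] at h
  have h' : π * (Real.cos (π * x) / Real.sin (π * x)) - 1 / x =
      -∑' n : ℕ, 2 * x / (((n : ℝ) + 1) ^ 2 - x ^ 2) := by
    exact_mod_cast h
  linarith

lemma zeta_eq (s : ℕ) : zeta s = ∑' n : ℕ, 1 / ((n : ℝ) + 1) ^ s := by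
  have := tsum_pnat_eq_tsum_succ (f := fun n : ℕ => (1 : ℝ) / (n : ℝ) ^ s)
  simpa [zeta] using this

/-- Power series of the cotangent. -/
lemma cot_hasSum (x : ℝ) (hx0 : x ≠ 0) (hx1 : |x| < 1) :
    HasSum (fun k : ℕ => 2 * zeta (2 * (k + 1)) * x ^ (2 * k + 1))
      (1 / x - π * (Real.cos (π * x) / Real.sin (π * x))) := by
  rw [real_cot_series x hx0 hx1]
  have hxx : |x| ^ 2 < 1 := by
    have := abs_nonneg x
    nlinarith
  set F : ℕ × ℕ → ℝ := fun p => 2 * x ^ (2 * p.1 + 1) * (1 / ((p.2 : ℝ) + 1) ^ (2 * (p.1 + 1)))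
    with hF
  have hz : Summable (fun n : ℕ => 1 / ((n : ℝ) + 1) ^ 2) := by
    have := (summable_nat_add_iff 1).mpr (Real.summable_one_div_nat_pow.mpr one_lt_two)
    simpa using this
  have hg : Summable (fun k : ℕ => 2 * |x| ^ (2 * k + 1)) := by
    have := (summable_geometric_of_lt_one (by positivity) hxx).mul_left (2 * |x|)
    refine this.congr fun k => ?_
    rw [← pow_mul]
    ring
  have hS : Summable F := by
    refine Summable.of_norm_bounded
      (hg.mul_of_nonneg hz (fun k => by positivity) (fun n => by positivity)) ?_
    rintro ⟨k, n⟩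
    have hn : (1 : ℝ) ≤ (n : ℝ) + 1 := by
      have : (0 : ℝ) ≤ n := n.cast_nonneg
      linarith
    simp only [hF, norm_mul, norm_pow, Real.norm_eq_abs, norm_div, norm_one]
    rw [abs_of_pos (by norm_num : (0 : ℝ) < 2), abs_of_pos (by linarith : (0 : ℝ) < (n : ℝ) + 1)]
    gcongr
    omega
  have h1 : ∀ k : ℕ, HasSum (fun n => F (k, n)) (2 * zeta (2 * (k + 1)) * x ^ (2 * k + 1)) := by
    intro k
    have := (hS.prod_factor k).hasSum
    convert! this using 1
    simp only [hF]
    rw [tsum_mul_left, zeta_eq]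
    ring
  have h2 : ∀ n : ℕ, HasSum (fun k => F (k, n)) (2 * x / (((n : ℝ) + 1) ^ 2 - x ^ 2)) := by
    intro n
    have hn : (1 : ℝ) ≤ (n : ℝ) + 1 := by
      have : (0 : ℝ) ≤ n := n.cast_nonneg
      linarith
    have hm0 : ((n : ℝ) + 1) ≠ 0 := by linarith
    have hxx' : x ^ 2 < 1 := by rwa [sq_abs] at hxx
    have hlt : x ^ 2 / ((n : ℝ) + 1) ^ 2 < 1 := by
      rw [div_lt_one (by positivity)]
      nlinarith
    have hne : ((n : ℝ) + 1) ^ 2 - x ^ 2 ≠ 0 := by nlinarith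
    have := (hasSum_geometric_of_lt_one (by positivity) hlt).mul_left
      (2 * x / ((n : ℝ) + 1) ^ 2)
    convert! this using 1
    · funext k
      simp only [hF]
      rw [div_pow, ← pow_mul, ← pow_mul]
      field_simp
      ring
    · have h3 : 1 - x ^ 2 / ((n : ℝ) + 1) ^ 2 = (((n : ℝ) + 1) ^ 2 - x ^ 2) / ((n : ℝ) + 1) ^ 2 := by
        field_simp
      rw [h3]
      field_simp
  have h3 := hS.hasSum.prod_fiberwise h1
  have hsw : HasSum (F ∘ Prod.swap) (∑' p, F p) :=
    (Equiv.prodComm ℕ ℕ).hasSum_iff.mpr hS.hasSum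
  have h4 := hsw.prod_fiberwise (f := F ∘ Prod.swap) h2
  rw [h4.tsum_eq]
  exact h3

/-- Power series of `tan`, odd terms only. -/
lemma tan_hasSum (y : ℝ) (hy : |y| < 1) :
    HasSum (fun k : ℕ =>
      2 * (4 ^ (k + 1) - 1) * zeta (2 * (k + 1)) / π ^ (2 * (k + 1)) * y ^ (2 * k + 1))
      (Real.tan y) := by
  by_cases hy0 : y = 0
  · subst hy0
    simp
  have hpi := Real.pi_gt_three
  have hpi0 : π ≠ 0 := Real.pi_ne_zero
  have hx : |y / π| < 1 / 2 := by
    rw [abs_div, abs_of_pos Real.pi_pos, div_lt_iff₀ Real.pi_pos]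
    linarith
  have hx0 : y / π ≠ 0 := div_ne_zero hy0 hpi0
  have A := cot_hasSum (y / π) hx0 (by linarith)
  have B := cot_hasSum (2 * (y / π)) (by positivity) (by
    rw [abs_mul, abs_of_pos (by norm_num : (0 : ℝ) < 2)]
    linarith)
  have C := ((B.mul_left 2).sub A).mul_left (1 / π)
  obtain ⟨ha, hb⟩ := abs_lt.mp hy
  have hcos : Real.cos y ≠ 0 :=
    (Real.cos_pos_of_mem_Ioo ⟨by linarith, by linarith⟩).ne'
  have hsin : Real.sin y ≠ 0 := by
    intro h0
    exact hy0 ((Real.sin_eq_zero_iff_of_lt_of_lt (by linarith) (by linarith)).mp h0)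
  convert! C using 1
  · funext k
    have h4 : (4 : ℝ) ^ (k + 1) = 2 * 2 ^ (2 * k + 1) := by
      rw [show (4 : ℝ) = 2 ^ 2 by norm_num, ← pow_mul]
      ring
    rw [h4, mul_pow, div_pow]
    field_simp
    ring
  · have e1 : π * (y / π) = y := by field_simp
    have e2 : π * (2 * (y / π)) = 2 * y := by field_simp
    rw [e1, e2, Real.sin_two_mul, Real.cos_two_mul, Real.tan_eq_sin_div_cos]
    field_simp
    have := Real.sin_sq_add_cos_sq y
    linear_combination y * this

/-- Value of the odd tangent numbers. -/
lemma t_odd (k : ℕ) : t (2 * k + 1) = (Nat.factorial (2 * k + 1) : ℝ) *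
    (2 * (4 ^ (k + 1) - 1) * zeta (2 * (k + 1)) / π ^ (2 * (k + 1))) := by
  set c : ℕ → ℝ := fun k => 2 * (4 ^ (k + 1) - 1) * zeta (2 * (k + 1)) / π ^ (2 * (k + 1)) with hc
  set a : ℕ → ℝ := fun n => if Odd n then c (n / 2) else 0 with ha
  have haodd : ∀ k, a (2 * k + 1) = c k := by
    intro k
    have h1 : Odd (2 * k + 1) := ⟨k, rfl⟩
    have h2 : (2 * k + 1) / 2 = k := by omega
    simp only [ha, h1, if_true, h2]
  have hinj : Function.Injective (fun k : ℕ => 2 * k + 1) := fun i j h => by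
    simp only at h
    omega
  have hp : HasFPowerSeriesAt Real.tan (FormalMultilinearSeries.ofScalars ℝ a) 0 := by
    rw [hasFPowerSeriesAt_iff]
    filter_upwards [Metric.ball_mem_nhds (0 : ℝ) one_pos] with y hy
    have hy' : |y| < 1 := by simpa using hy
    rw [zero_add, ← hinj.hasSum_iff]
    · convert! tan_hasSum y hy' using 1
      funext k
      simp only [Function.comp, FormalMultilinearSeries.coeff_ofScalars, haodd, smul_eq_mul, hc]
      ring
    · intro n hn
      have : ¬ Odd n := fun ⟨j, hj⟩ => hn ⟨j, hj.symm⟩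
      simp [FormalMultilinearSeries.coeff_ofScalars, ha, this]
  obtain ⟨r, hr⟩ := hp
  have := hr.factorial_smul 1 (2 * k + 1)
  rw [t, iteratedDeriv_eq_iteratedFDeriv, ← this]
  change _ • (FormalMultilinearSeries.ofScalars ℝ a).coeff (2 * k + 1) = _
  rw [FormalMultilinearSeries.coeff_ofScalars, haodd, nsmul_eq_mul]

/-- For `l ≥ 2` and `1 ≤ k ≤ l−1`,
`C(2l−2, 2k−1) · t_{2k−1} · t_{2(l−k)−1} = (4 (2l−2)! / π^{2l}) · f_k`, so that the
probability that the left subtree of a uniform strictly increasing binary tree of size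
`2l−1` has size `2k−1` is proportional to `f_k`. -/
theorem choose_mul_t_mul_t (l k : ℕ) (hl : 2 ≤ l) (hk : 1 ≤ k) (hk' : k ≤ l - 1) :
    ((2 * l - 2).choose (2 * k - 1) : ℝ) * t (2 * k - 1) * t (2 * (l - k) - 1) =
      4 * (Nat.factorial (2 * l - 2) : ℝ) / π ^ (2 * l) * f l k := by
  obtain ⟨i, rfl⟩ : ∃ i, k = i + 1 := ⟨k - 1, by omega⟩
  obtain ⟨j, rfl⟩ : ∃ j, l = i + 1 + (j + 1) := ⟨l - i - 2, by omega⟩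
  have e1 : 2 * (i + 1) - 1 = 2 * i + 1 := by omega
  have e2 : i + 1 + (j + 1) - (i + 1) = j + 1 := by omega
  have e3 : 2 * (j + 1) - 1 = 2 * j + 1 := by omega
  have e4 : 2 * (i + 1 + (j + 1)) - 2 = (2 * i + 1) + (2 * j + 1) := by omega
  rw [f, e1, e2, e3, e4, Nat.choose_symm_add, t_odd, t_odd,
    ← Nat.add_choose_mul_factorial_mul_factorial (2 * i + 1) (2 * j + 1)]
  have hpi0 : π ≠ 0 := Real.pi_ne_zero
  push_cast
  field_simp
  ring
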